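/- arXiv:2403.11351 — 6 statements merged into one kernel-verified Lean document; each statement's English description precedes it below -/
import Mathlib

section
/- Let Y ∈ ℝ^{n×k} be entrywise nonnegative and satisfy Yᵀ Y = I_k and Y Yᵀ 1_n = 1_n. Then there exists a partition matrix X ∈ {0,1}^{n×k} (every row of X has exactly one entry equal to 1 and every column sum n_j = Σ_{i=1}^n X_{ij} is positive) such that Y = X·Diag(n_1^{-1/2}, …, n_k^{-1/2}); in particular, every row of Y has exactly one positive entry, and every nonzero entry in column j of Y equals n_j^{-1/2} where n_j is the number of nonzero entries in that column. -/
open Matrix BigOperators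

/-- A nonnegative matrix with orthonormal columns has at most one nonzero entry in each row. -/
lemma eq_of_ne_zero_of_transpose_mul_self_eq_one {m n : Type*} [Fintype m] [DecidableEq n]
    {Y : Matrix m n ℝ} (hnonneg : ∀ i j, 0 ≤ Y i j) (horth : Yᵀ * Y = 1)
    {i : m} {j j' : n} (hj : Y i j ≠ 0) (hj' : Y i j' ≠ 0) : j = j' := by
  by_contra hne
  have h := congrFun (congrFun horth j) j'
  simp only [Matrix.one_apply_ne hne, Matrix.mul_apply, Matrix.transpose_apply] at h
  rw [Finset.sum_eq_zero_iff_of_nonneg fun a _ => mul_nonneg (hnonneg a j) (hnonneg a j')] at h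
  exact mul_ne_zero hj hj' (h i (Finset.mem_univ i))

/-- If `Y * Yᵀ` fixes the all-ones vector, then each row of `Y` weighted by the column sums
adds up to one. -/
lemma sum_mul_colSum_eq_one {m n : Type*} [Fintype m] [Fintype n]
    {Y : Matrix m n ℝ} (hstoc : (Y * Yᵀ) *ᵥ (1 : m → ℝ) = 1) (i : m) :
    ∑ j, Y i j * ∑ a, Y a j = 1 := by
  have h := congrFun hstoc i
  rw [← Matrix.mulVec_mulVec] at h
  simpa [Matrix.mulVec, dotProduct] using h

/-- If all nonzero entries of a vector with unit sum of squares equal `c ≥ 0`, then `c` is the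
inverse square root of the number of nonzero entries. -/
lemma eq_inv_sqrt_card_of_sum_mul_self_eq_one {m : Type*} [Fintype m] {v : m → ℝ} {c : ℝ}
    (hc : 0 ≤ c) (hv : ∀ a, v a ≠ 0 → v a = c) (hsum : ∑ a, v a * v a = 1) :
    c = (√((Finset.univ.filter (fun a => v a ≠ 0)).card))⁻¹ := by
  have h : ((Finset.univ.filter (fun a => v a ≠ 0)).card : ℝ) * (c * c) = 1 := by
    rw [← hsum, ← nsmul_eq_mul, ← Finset.sum_const, Finset.sum_filter]
    refine Finset.sum_congr rfl fun a _ => ?_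
    split_ifs with ha
    · rw [hv a ha]
    · rw [not_not.mp ha, mul_zero]
  rw [eq_inv_of_mul_eq_one_left h, Real.sqrt_inv, inv_inv, Real.sqrt_mul_self hc]

/-- If `Y ∈ ℝ^{n×k}` is entrywise nonnegative with `Yᵀ Y = I_k` and
`Y Yᵀ 1_n = 1_n`, then `Y = X·Diag(n_1^{-1/2}, …, n_k^{-1/2})` for a partition matrix `X`;
in particular every row of `Y` has exactly one positive entry and every nonzero entry of
column `j` equals `n_j^{-1/2}` where `n_j` is the number of nonzero entries of that column. -/
theorem stmt2 (n k : ℕ) (Y : Matrix (Fin n) (Fin k) ℝ)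
    (hnonneg : ∀ i j, 0 ≤ Y i j)
    (horth : Yᵀ * Y = (1 : Matrix (Fin k) (Fin k) ℝ))
    (hstoc : (Y * Yᵀ) *ᵥ (1 : Fin n → ℝ) = 1) :
    (∃ X : Matrix (Fin n) (Fin k) ℝ,
      (∀ i j, X i j = 0 ∨ X i j = 1) ∧
      (∀ i, ∃! j, X i j = 1) ∧
      (∀ j, 0 < ∑ i, X i j) ∧
      Y = X * Matrix.diagonal (fun j : Fin k => (Real.sqrt (∑ i, X i j))⁻¹)) ∧
    (∀ i : Fin n, ∃! j : Fin k, 0 < Y i j) ∧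
    (∀ (j : Fin k) (i : Fin n), Y i j ≠ 0 →
      Y i j = (Real.sqrt ((Finset.univ.filter (fun i' : Fin n => Y i' j ≠ 0)).card))⁻¹) := by
  have huniq : ∀ {i j j'}, Y i j ≠ 0 → Y i j' ≠ 0 → j = j' :=
    eq_of_ne_zero_of_transpose_mul_self_eq_one hnonneg horth
  have hrow := sum_mul_colSum_eq_one hstoc
  have hex : ∀ i, ∃ j, Y i j ≠ 0 := by
    intro i
    by_contra! h
    simpa [h] using hrow i
  have hinv : ∀ i j, Y i j ≠ 0 → Y i j = (∑ a, Y a j)⁻¹ := by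
    intro i j hij
    have h := hrow i
    rw [Finset.sum_eq_single j (fun j' _ hne => ?_) (by simp)] at h
    · exact eq_inv_of_mul_eq_one_left h
    · rw [not_not.mp fun h' => hne (huniq h' hij), zero_mul]
  have hsq : ∀ j, ∑ a, Y a j * Y a j = 1 := by
    intro j
    simpa [Matrix.mul_apply] using congrFun (congrFun horth j) j
  have hval : ∀ (j : Fin k) (i : Fin n), Y i j ≠ 0 →
      Y i j = (Real.sqrt ((Finset.univ.filter (fun i' : Fin n => Y i' j ≠ 0)).card))⁻¹ :=
    fun j i hij => (hinv i j hij).trans <| eq_inv_sqrt_card_of_sum_mul_self_eq_one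
      (inv_nonneg.mpr (Finset.sum_nonneg fun a _ => hnonneg a j)) (fun a => hinv a j) (hsq j)
  have hcard : ∀ j, ∑ i, (if Y i j ≠ 0 then (1 : ℝ) else 0) =
      (Finset.univ.filter (fun i' : Fin n => Y i' j ≠ 0)).card := fun j => Finset.sum_boole _ _
  refine ⟨⟨Matrix.of fun i j => if Y i j ≠ 0 then 1 else 0, fun i j => ?_, fun i => ?_, fun j => ?_, ?_⟩,
    fun i => ?_, hval⟩
  · by_cases h : Y i j = 0 <;> simp [h]
  · obtain ⟨j, hj⟩ := hex i
    exact ⟨j, if_pos hj, fun j' hj' => huniq (by by_contra h; simp [h] at hj') hj⟩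
  · simp only [Matrix.of_apply]
    rw [hcard, Nat.cast_pos, Finset.card_pos]
    by_contra h
    have h0 : ∀ a, Y a j = 0 := by
      simpa [Finset.filter_eq_empty_iff] using Finset.not_nonempty_iff_eq_empty.mp h
    simpa [h0] using hsq j
  · ext i j
    simp only [Matrix.mul_diagonal, Matrix.of_apply, hcard]
    by_cases h : Y i j = 0
    · simp [h]
    · rw [if_pos h, one_mul]
      exact hval j i h
  · obtain ⟨j, hj⟩ := hex i
    exact ⟨j, (hnonneg i j).lt_of_ne' hj, fun j' hj' => huniq hj'.ne' hj⟩
end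

section
/- Let Y_U ∈ ℝ^{n×k} and Y_V ∈ ℝ^{m×k} be entrywise nonnegative matrices satisfying Y_Uᵀ Y_U = I_k, Y_Vᵀ Y_V = I_k, Y_U Y_Uᵀ 1_n = 1_n, and Y_V Y_Vᵀ 1_m = 1_m. Define the block matrix Z = [[Y_U Y_Uᵀ, Y_U Y_Vᵀ],[Y_V Y_Uᵀ, Y_V Y_Vᵀ]] ∈ 𝕊^{n+m}. Then Z is positive semidefinite, entrywise nonnegative, its upper-left n×n block Z_UU = Y_U Y_Uᵀ satisfies Z_UU 1_n = 1_n and tr(Z_UU) = k, its lower-right m×m block Z_VV = Y_V Y_Vᵀ satisfies Z_VV 1_m = 1_m and tr(Z_VV) = k, and rank(Z) = k. -/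
open Matrix BigOperators

theorem Matrix.rank_eq_card_of_mul_eq_one {ι κ : Type*} [Fintype ι] [Fintype κ] [DecidableEq κ]
    {A : Matrix κ ι ℝ} {B : Matrix ι κ ℝ} (h : A * B = 1) : B.rank = Fintype.card κ := by
  refine le_antisymm B.rank_le_card_width ?_
  rw [← rank_one (R := ℝ) (n := κ), ← h]
  exact rank_mul_le_right A B

theorem Matrix.fromRows_mul_transpose_self {ι κ l : Type*} [Fintype l]
    (A : Matrix ι l ℝ) (B : Matrix κ l ℝ) :
    fromRows A B * (fromRows A B)ᵀ = fromBlocks (A * Aᵀ) (A * Bᵀ) (B * Aᵀ) (B * Bᵀ) := by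
  rw [transpose_fromRows, fromRows_mul_fromCols]

theorem Matrix.trace_self_mul_transpose_of_orthonormal {ι κ : Type*} [Fintype ι] [Fintype κ]
    [DecidableEq κ] {A : Matrix ι κ ℝ} (h : Aᵀ * A = 1) :
    (A * Aᵀ).trace = Fintype.card κ := by
  rw [trace_mul_comm, h, trace_one]

/-- If `Y_U ∈ ℝ^{n×k}`, `Y_V ∈ ℝ^{m×k}` are entrywise nonnegative with
orthonormal columns and `Y_U Y_Uᵀ 1_n = 1_n`, `Y_V Y_Vᵀ 1_m = 1_m`, then the block matrix
`Z = [[Y_U Y_Uᵀ, Y_U Y_Vᵀ],[Y_V Y_Uᵀ, Y_V Y_Vᵀ]]` is positive semidefinite, entrywise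
nonnegative, its diagonal blocks are stochastic with trace `k`, and `rank(Z) = k`. -/
theorem stmt4 (n m k : ℕ)
    (YU : Matrix (Fin n) (Fin k) ℝ) (YV : Matrix (Fin m) (Fin k) ℝ)
    (hUnn : ∀ i j, 0 ≤ YU i j) (hVnn : ∀ i j, 0 ≤ YV i j)
    (hUo : YUᵀ * YU = (1 : Matrix (Fin k) (Fin k) ℝ))
    (hVo : YVᵀ * YV = (1 : Matrix (Fin k) (Fin k) ℝ))
    (hUs : (YU * YUᵀ) *ᵥ (1 : Fin n → ℝ) = 1)
    (hVs : (YV * YVᵀ) *ᵥ (1 : Fin m → ℝ) = 1) :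
    ∀ Z : Matrix (Fin n ⊕ Fin m) (Fin n ⊕ Fin m) ℝ,
      Z = Matrix.fromBlocks (YU * YUᵀ) (YU * YVᵀ) (YV * YUᵀ) (YV * YVᵀ) →
      Z.PosSemidef ∧ (∀ a b, 0 ≤ Z a b) ∧
      (YU * YUᵀ) *ᵥ (1 : Fin n → ℝ) = 1 ∧ (YU * YUᵀ).trace = (k : ℝ) ∧
      (YV * YVᵀ) *ᵥ (1 : Fin m → ℝ) = 1 ∧ (YV * YVᵀ).trace = (k : ℝ) ∧
      Z.rank = k := by
  rintro Z rfl
  refine ⟨?_, ?_, hUs, by simpa using trace_self_mul_transpose_of_orthonormal hUo,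
    hVs, by simpa using trace_self_mul_transpose_of_orthonormal hVo, ?_⟩
  · rw [← fromRows_mul_transpose_self, ← conjTranspose_eq_transpose_of_trivial]
    exact posSemidef_self_mul_conjTranspose _
  · have hnn : ∀ a j, 0 ≤ fromRows YU YV a j := by
      rintro (i | i) j
      exacts [hUnn i j, hVnn i j]
    intro a b
    rw [← fromRows_mul_transpose_self, mul_apply]
    exact Finset.sum_nonneg fun j _ => mul_nonneg (hnn a j) (hnn b j)
  · have hinv : fromCols YUᵀ (0 : Matrix (Fin k) (Fin m) ℝ) * fromRows YU YV = 1 := by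
      rw [fromCols_mul_fromRows, hUo, Matrix.zero_mul, add_zero]
    rw [← fromRows_mul_transpose_self, rank_self_mul_transpose,
      rank_eq_card_of_mul_eq_one hinv, Fintype.card_fin]
end

section
/- Let A ∈ ℝ^{n×m}, let k be a positive integer, and let Z = [[Z_UU, Z_UV],[Z_UVᵀ, Z_VV]] ∈ 𝕊^{n+m} (with Z_UU ∈ 𝕊^n, Z_VV ∈ 𝕊^m) be positive semidefinite, entrywise nonnegative, and satisfy Z_UU 1_n = 1_n, Z_VV 1_m = 1_m, tr(Z_UU) = k, tr(Z_VV) = k, and rank(Z) = k. Then there exist entrywise nonnegative matrices Y_U ∈ ℝ^{n×k} and Y_V ∈ ℝ^{m×k} with Y_Uᵀ Y_U = I_k, Y_Vᵀ Y_V = I_k, Y_U Y_Uᵀ 1_n = 1_n, Y_V Y_Vᵀ 1_m = 1_m, such that tr(Y_Uᵀ A Y_V) = (1/2)·tr(W Z), where W = [[0, A],[Aᵀ, 0]] ∈ 𝕊^{n+m}. -/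
open Matrix BigOperators

/-- The trace of a block matrix is the sum of the traces of its diagonal blocks. -/
theorem Matrix.trace_fromBlocks {ι κ R : Type*} [Fintype ι] [Fintype κ] [AddCommMonoid R]
    (A : Matrix ι ι R) (B : Matrix ι κ R) (C : Matrix κ ι R) (D : Matrix κ κ R) :
    (fromBlocks A B C D).trace = A.trace + D.trace := by
  simp [trace]

/-- A symmetric matrix whose quadratic form is at most `c ‖x‖²` and whose trace is at least
`c` times its rank satisfies `M² = c M`. -/
theorem Matrix.IsHermitian.mul_self_eq_smul_of_rank_mul_le_trace {ι : Type*} [Fintype ι]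
    [DecidableEq ι] {M : Matrix ι ι ℝ} (hM : M.IsHermitian) {c : ℝ}
    (hub : ∀ x : ι → ℝ, x ⬝ᵥ M *ᵥ x ≤ c * (x ⬝ᵥ x)) (htr : c * M.rank ≤ M.trace) :
    M * M = c • M := by
  have hle (i : ι) : hM.eigenvalues i ≤ c := by
    have h := hub (hM.eigenvectorBasis i)
    have h1 : (hM.eigenvectorBasis i : ι → ℝ) ⬝ᵥ hM.eigenvectorBasis i = 1 := by
      have := hM.eigenvectorBasis.orthonormal.1 i
      have h2 := real_inner_self_eq_norm_sq (hM.eigenvectorBasis i)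
      rw [this, EuclideanSpace.inner_eq_star_dotProduct] at h2
      simpa using h2
    rw [hM.mulVec_eigenvectorBasis, dotProduct_smul, h1] at h
    simpa using h
  have heq (i : ι) : hM.eigenvalues i * hM.eigenvalues i = c * hM.eigenvalues i := by
    have hsum : ∑ i, (if hM.eigenvalues i ≠ 0 then c - hM.eigenvalues i else 0) ≤ 0 := by
      have hc : c * M.rank = ∑ i, (if hM.eigenvalues i ≠ 0 then c else 0) := by
        rw [hM.rank_eq_card_non_zero_eigs, Fintype.card_subtype, ← Finset.sum_filter]
        simp [mul_comm]
      have ht : M.trace = ∑ i, (if hM.eigenvalues i ≠ 0 then hM.eigenvalues i else 0) := by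
        rw [hM.trace_eq_sum_eigenvalues]
        exact Finset.sum_congr rfl fun i _ ↦ by split_ifs <;> simp_all
      rw [hc, ht, ← sub_nonpos, ← Finset.sum_sub_distrib] at htr
      refine le_of_eq_of_le (Finset.sum_congr rfl fun i _ ↦ ?_) htr
      split_ifs <;> simp
    have hnn : ∀ j ∈ Finset.univ,
        0 ≤ (if hM.eigenvalues j ≠ 0 then c - hM.eigenvalues j else 0) := fun j _ ↦ by
      split_ifs
      · exact sub_nonneg.2 (hle j)
      · exact le_rfl
    have hz := (Finset.sum_eq_zero_iff_of_nonneg hnn).1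
      (le_antisymm hsum (Finset.sum_nonneg hnn)) i (Finset.mem_univ i)
    by_cases h0 : hM.eigenvalues i = 0
    · simp [h0]
    · rw [if_pos h0, sub_eq_zero] at hz
      rw [hz]
  rw [hM.spectral_theorem, ← map_mul, ← map_smul, diagonal_mul_diagonal, ← diagonal_smul]
  congr 2
  funext i
  simpa using heq i

/-- The Dirichlet form of a symmetric matrix with unit row sums. -/
theorem Matrix.IsSymm.sum_mul_sub_sq {ι : Type*} [Fintype ι] {P : Matrix ι ι ℝ}
    (hP : P.IsSymm) (h1 : P *ᵥ 1 = 1) (x : ι → ℝ) :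
    ∑ i, ∑ j, P i j * (x i - x j) ^ 2 = 2 * (x ⬝ᵥ x - x ⬝ᵥ P *ᵥ x) := by
  have hrow (i : ι) : ∑ j, P i j = 1 := by simpa [mulVec, dotProduct] using congrFun h1 i
  have hcol (j : ι) : ∑ i, P i j = 1 := by
    rw [← hrow j]
    exact Finset.sum_congr rfl fun i _ ↦ hP.apply j i
  have e1 : ∑ i, ∑ j, P i j * x i ^ 2 = x ⬝ᵥ x := by
    simp [← Finset.sum_mul, hrow, dotProduct, sq]
  have e2 : ∑ i, ∑ j, P i j * x j ^ 2 = x ⬝ᵥ x := by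
    rw [Finset.sum_comm]
    simp [← Finset.sum_mul, hcol, dotProduct, sq]
  have e3 : ∑ i, ∑ j, P i j * (x i * x j) = x ⬝ᵥ P *ᵥ x := by
    simp only [dotProduct, mulVec, Finset.mul_sum]
    exact Finset.sum_congr rfl fun i _ ↦ Finset.sum_congr rfl fun j _ ↦ by ring
  calc _ = ∑ i, ∑ j, (P i j * x i ^ 2 + P i j * x j ^ 2 - 2 * (P i j * (x i * x j))) :=
        Finset.sum_congr rfl fun i _ ↦ Finset.sum_congr rfl fun j _ ↦ by ring
    _ = _ := by
        simp only [Finset.sum_sub_distrib, Finset.sum_add_distrib, ← Finset.mul_sum, e1, e2, e3]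
        ring

/-- The quadratic form of a symmetric stochastic matrix is at most `‖x‖²`. -/
theorem Matrix.IsSymm.dotProduct_mulVec_le {ι : Type*} [Fintype ι] {P : Matrix ι ι ℝ}
    (hP : P.IsSymm) (h0 : ∀ i j, 0 ≤ P i j) (h1 : P *ᵥ 1 = 1) (x : ι → ℝ) :
    x ⬝ᵥ P *ᵥ x ≤ x ⬝ᵥ x := by
  have h := hP.sum_mul_sub_sq h1 x
  have : 0 ≤ ∑ i, ∑ j, P i j * (x i - x j) ^ 2 :=
    Finset.sum_nonneg fun i _ ↦ Finset.sum_nonneg fun j _ ↦ mul_nonneg (h0 i j) (sq_nonneg _)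
  linarith

/-- A symmetric idempotent stochastic matrix is the normalized indicator matrix of the partition
into classes of equal rows. -/
theorem Matrix.IsSymm.apply_eq_ite_of_mul_self {ι : Type*} [Fintype ι] [DecidableEq ι]
    {P : Matrix ι ι ℝ} (hP : P.IsSymm) (h0 : ∀ i j, 0 ≤ P i j) (h1 : P *ᵥ 1 = 1)
    (hPP : P * P = P) (i j : ι) : P i j = if P.row i = P.row j then P i i else 0 := by
  have hconst (a b c : ι) (hab : P a b ≠ 0) : P a c = P b c := by
    have hfix : P *ᵥ (fun a ↦ P a c) = fun a ↦ P a c := by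
      ext a
      exact congrFun (congrFun hPP a) c
    have h := hP.sum_mul_sub_sq h1 fun a ↦ P a c
    rw [hfix, sub_self, mul_zero] at h
    have hnn (i j : ι) : 0 ≤ P i j * (P i c - P j c) ^ 2 := mul_nonneg (h0 i j) (sq_nonneg _)
    have ha := (Finset.sum_eq_zero_iff_of_nonneg
      fun i _ ↦ Finset.sum_nonneg fun j _ ↦ hnn i j).1 h a (Finset.mem_univ a)
    have hb := (Finset.sum_eq_zero_iff_of_nonneg fun j _ ↦ hnn a j).1 ha b (Finset.mem_univ b)
    simpa [hab, sub_eq_zero] using hb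
  split_ifs with h
  · rw [← hP.apply i j]
    exact (congrFun h i).symm
  · by_contra hne
    exact h (funext fun c ↦ hconst i j c hne)

/-- A symmetric idempotent stochastic matrix of trace `k` factors as `Y Yᵀ` with `Y` entrywise
nonnegative with `k` orthonormal columns. -/
theorem Matrix.IsSymm.exists_nonneg_mul_transpose_eq {ι : Type*} [Fintype ι] [DecidableEq ι]
    {P : Matrix ι ι ℝ} (hP : P.IsSymm) (h0 : ∀ i j, 0 ≤ P i j) (h1 : P *ᵥ 1 = 1)
    (hPP : P * P = P) {k : ℕ} (htr : P.trace = k) :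
    ∃ Y : Matrix ι (Fin k) ℝ, (∀ i j, 0 ≤ Y i j) ∧ Yᵀ * Y = 1 ∧ Y * Yᵀ = P := by
  classical
  have hite := hP.apply_eq_ite_of_mul_self h0 h1 hPP
  have hdiag (i j : ι) (h : P.row i = P.row j) : P i i = P j j := by
    have h1 := hite i j
    have h2 := hite j i
    rw [if_pos h] at h1
    rw [if_pos h.symm] at h2
    rw [← h1, ← h2, hP.apply j i]
  let Y : Matrix ι (Set.range P.row) ℝ := of fun i c ↦ if P.row i = c then √(P i i) else 0
  have hY (i c) : Y i c = if P.row i = c then √(P i i) else 0 := rfl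
  have hYY : Y * Yᵀ = P := by
    ext i j
    rw [hite i j, mul_apply, Finset.sum_eq_single ⟨P.row i, i, rfl⟩]
    · rw [transpose_apply, hY, hY, if_pos rfl]
      by_cases h : P.row i = P.row j
      · rw [if_pos h.symm, if_pos h, ← hdiag i j h, Real.mul_self_sqrt (h0 i i)]
      · rw [if_neg (Ne.symm h), if_neg h, mul_zero]
    · intro c _ hc
      rw [hY, if_neg fun h ↦ hc (Subtype.ext h.symm), zero_mul]
    · simp
  have hY1 : Yᵀ * Y = 1 := by
    ext ⟨c, a, rfl⟩ ⟨d, b, rfl⟩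
    rw [mul_apply, one_apply]
    simp only [transpose_apply, hY]
    split_ifs with h
    · have hrow : ∑ i, P a i = 1 := by simpa [mulVec, dotProduct] using congrFun h1 a
      rw [← hrow]
      refine Finset.sum_congr rfl fun i _ ↦ ?_
      have hab : P.row a = P.row b := congrArg Subtype.val h
      rw [hite a i]
      by_cases hi : P.row i = P.row a
      · rw [if_pos hi, if_pos (hi.trans hab), if_pos hi.symm, hdiag i a hi, Real.mul_self_sqrt (h0 a a)]
      · rw [if_neg hi, if_neg (Ne.symm hi), zero_mul]
    · refine Finset.sum_eq_zero fun i _ ↦ ?_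
      by_cases hi : P.row i = P.row a
      · rw [if_neg fun hb ↦ h (Subtype.ext (hi.symm.trans hb)), mul_zero]
      · rw [if_neg hi, zero_mul]
  have hcard : Fintype.card (Set.range P.row) = k := by
    have := trace_mul_comm Y Yᵀ
    rw [hYY, hY1, htr, trace_one] at this
    exact_mod_cast this.symm
  let e : Fin k ≃ Set.range P.row := (Fintype.equivFinOfCardEq hcard).symm
  refine ⟨Y.submatrix id e, fun i j ↦ ?_, ?_, ?_⟩
  · rw [submatrix_apply, hY]
    split_ifs <;> positivity
  · rw [transpose_submatrix, ← submatrix_mul _ _ e id e Function.bijective_id, hY1,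
      submatrix_one_equiv]
  · rw [transpose_submatrix, ← submatrix_mul _ _ id e id e.bijective, hYY, submatrix_id_id]

/-- If `Z = [[Z_UU, Z_UV],[Z_UVᵀ, Z_VV]]` is positive semidefinite, entrywise
nonnegative, with stochastic diagonal blocks of trace `k` and `rank(Z) = k`, then there exist
entrywise nonnegative `Y_U, Y_V` with orthonormal columns, `Y_U Y_Uᵀ 1_n = 1_n`,
`Y_V Y_Vᵀ 1_m = 1_m`, and `tr(Y_Uᵀ A Y_V) = (1/2)·tr(W Z)` where `W = [[0, A],[Aᵀ, 0]]`. -/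
theorem stmt5 (n m k : ℕ) (hk : 0 < k) (A : Matrix (Fin n) (Fin m) ℝ)
    (ZUU : Matrix (Fin n) (Fin n) ℝ) (ZUV : Matrix (Fin n) (Fin m) ℝ)
    (ZVV : Matrix (Fin m) (Fin m) ℝ)
    (hZUU : ZUU.IsSymm) (hZVV : ZVV.IsSymm)
    (hpsd : (Matrix.fromBlocks ZUU ZUV ZUVᵀ ZVV).PosSemidef)
    (hnn : ∀ a b, 0 ≤ Matrix.fromBlocks ZUU ZUV ZUVᵀ ZVV a b)
    (hrU : ZUU *ᵥ (1 : Fin n → ℝ) = 1) (hrV : ZVV *ᵥ (1 : Fin m → ℝ) = 1)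
    (htU : ZUU.trace = (k : ℝ)) (htV : ZVV.trace = (k : ℝ))
    (hrank : (Matrix.fromBlocks ZUU ZUV ZUVᵀ ZVV).rank = k) :
    ∃ (YU : Matrix (Fin n) (Fin k) ℝ) (YV : Matrix (Fin m) (Fin k) ℝ),
      (∀ i j, 0 ≤ YU i j) ∧ (∀ i j, 0 ≤ YV i j) ∧
      YUᵀ * YU = (1 : Matrix (Fin k) (Fin k) ℝ) ∧
      YVᵀ * YV = (1 : Matrix (Fin k) (Fin k) ℝ) ∧
      (YU * YUᵀ) *ᵥ (1 : Fin n → ℝ) = 1 ∧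
      (YV * YVᵀ) *ᵥ (1 : Fin m → ℝ) = 1 ∧
      (YUᵀ * A * YV).trace =
        (1 / 2 : ℝ) * ((Matrix.fromBlocks 0 A Aᵀ 0) *
          (Matrix.fromBlocks ZUU ZUV ZUVᵀ ZVV)).trace := by
  have h0U (i j) : 0 ≤ ZUU i j := hnn (.inl i) (.inl j)
  have h0V (i j) : 0 ≤ ZVV i j := hnn (.inr i) (.inr j)
  have h0B (i j) : 0 ≤ ZUV i j := hnn (.inl i) (.inr j)
  have hubU := hZUU.dotProduct_mulVec_le h0U hrU
  have hubV := hZVV.dotProduct_mulVec_le h0V hrV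
  have hPP : ZUU * ZUU = ZUU := by
    have hr : ZUU.rank ≤ k :=
      (rank_submatrix_le (fromBlocks ZUU ZUV ZUVᵀ ZVV) Sum.inl Sum.inl).trans_eq hrank
    have hH : ZUU.IsHermitian := by rwa [IsHermitian, conjTranspose_eq_transpose_of_trivial]
    simpa using hH.mul_self_eq_smul_of_rank_mul_le_trace (c := 1) (by simpa using hubU)
      (by rw [htU, one_mul]; exact_mod_cast hr)
  have hQQ : ZVV * ZVV = ZVV := by
    have hr : ZVV.rank ≤ k :=
      (rank_submatrix_le (fromBlocks ZUU ZUV ZUVᵀ ZVV) Sum.inr Sum.inr).trans_eq hrank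
    have hH : ZVV.IsHermitian := by rwa [IsHermitian, conjTranspose_eq_transpose_of_trivial]
    simpa using hH.mul_self_eq_smul_of_rank_mul_le_trace (c := 1) (by simpa using hubV)
      (by rw [htV, one_mul]; exact_mod_cast hr)
  have hZZ := hpsd.1.mul_self_eq_smul_of_rank_mul_le_trace (c := 2) (fun x ↦ by
    obtain ⟨u, v, rfl⟩ : ∃ u v, x = Sum.elim u v :=
      ⟨x ∘ Sum.inl, x ∘ Sum.inr, (Sum.elim_comp_inl_inr x).symm⟩
    have h := hpsd.dotProduct_mulVec_nonneg (Sum.elim u (-v))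
    simp only [star_trivial, fromBlocks_mulVec, Sum.elim_comp_inl, Sum.elim_comp_inr,
      sumElim_dotProduct_sumElim, mulVec_neg, dotProduct_add, dotProduct_neg,
      neg_dotProduct] at h ⊢
    linarith [hubU u, hubV v])
    (by rw [hrank, trace_fromBlocks, htU, htV]; linarith)
  rw [fromBlocks_multiply, fromBlocks_smul, fromBlocks_inj] at hZZ
  obtain ⟨hUU, hUV, -, hVV⟩ := hZZ
  have hBBt : ZUV * ZUVᵀ = ZUU := by
    rw [hPP, two_smul] at hUU
    exact add_left_cancel hUU
  have hBtB : ZUVᵀ * ZUV = ZVV := by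
    rw [hQQ, two_smul] at hVV
    exact add_right_cancel hVV
  have hPB : ZUU * ZUV = ZUV := by
    rw [← hBtB, ← Matrix.mul_assoc, hBBt, ← two_smul ℝ] at hUV
    exact smul_right_injective _ two_ne_zero hUV
  obtain ⟨Y, hY0, hY1, hYY⟩ := hZUU.exists_nonneg_mul_transpose_eq h0U hrU hPP htU
  refine ⟨Y, ZUVᵀ * Y, hY0, fun i j ↦ ?_, hY1, ?_, ?_, ?_, ?_⟩
  · rw [mul_apply]
    exact Finset.sum_nonneg fun a _ ↦ mul_nonneg (h0B a i) (hY0 a j)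
  · calc (ZUVᵀ * Y)ᵀ * (ZUVᵀ * Y) = Yᵀ * (ZUV * ZUVᵀ) * Y := by
          simp only [transpose_mul, transpose_transpose, Matrix.mul_assoc]
      _ = (Yᵀ * Y) * (Yᵀ * Y) := by rw [hBBt, ← hYY]; simp only [Matrix.mul_assoc]
      _ = 1 := by rw [hY1, Matrix.mul_one]
  · rw [hYY, hrU]
  · have : ZUVᵀ * Y * (ZUVᵀ * Y)ᵀ = ZUVᵀ * ((Y * Yᵀ) * ZUV) := by
      simp only [transpose_mul, transpose_transpose, Matrix.mul_assoc]
    rw [this, hYY, hPB, hBtB, hrV]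
  · have hBP : ZUVᵀ * ZUU = ZUVᵀ := by
      simpa [transpose_mul, hZUU.eq] using congrArg transpose hPB
    have hl : (Yᵀ * A * (ZUVᵀ * Y)).trace = (A * ZUVᵀ).trace := by
      rw [Matrix.mul_assoc, trace_mul_comm, Matrix.mul_assoc, Matrix.mul_assoc, hYY, hBP]
    have hr : (Aᵀ * ZUV).trace = (A * ZUVᵀ).trace := by
      rw [← trace_transpose, transpose_mul, transpose_transpose, trace_mul_comm]
    rw [hl, fromBlocks_multiply, trace_fromBlocks]
    simp only [Matrix.zero_mul, zero_add, add_zero, hr]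
    ring
end

section
/- Let Z = [[Z_UU, Z_UV],[Z_UVᵀ, Z_VV]] ∈ 𝕊^{n+m} be positive semidefinite, and suppose the diagonal blocks are stochastic: Z_UU ∈ 𝕊^n is entrywise nonnegative with Z_UU 1_n = 1_n, and Z_VV ∈ 𝕊^m is entrywise nonnegative with Z_VV 1_m = 1_m. Then λ_max(Z) ≤ 2; equivalently, vᵀ Z v ≤ 2‖v‖² for every v ∈ ℝ^{n+m}. -/
open Matrix BigOperators

/-- The quadratic form of a symmetric stochastic matrix is bounded by the squared Euclidean norm. -/
theorem Matrix.dotProduct_mulVec_le_sum_sq_of_stochastic {ι : Type*} [Fintype ι]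
    {A : Matrix ι ι ℝ} (hA : A.IsSymm) (hnn : ∀ a b, 0 ≤ A a b)
    (hs : A *ᵥ (1 : ι → ℝ) = 1) (x : ι → ℝ) :
    x ⬝ᵥ (A *ᵥ x) ≤ ∑ a, x a ^ 2 := by
  have hrow : ∀ a, ∑ b, A a b = 1 := fun a => by
    simpa [Matrix.mulVec, dotProduct] using congrFun hs a
  have h₁ : ∑ a, ∑ b, A a b * x a ^ 2 = ∑ a, x a ^ 2 := by
    simp [← Finset.sum_mul, hrow]
  have h₂ : ∑ a, ∑ b, A a b * x b ^ 2 = ∑ a, x a ^ 2 := by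
    rw [Finset.sum_comm, ← h₁]
    simp only [hA.apply]
  have h₃ : 2 * (x ⬝ᵥ (A *ᵥ x)) ≤ ∑ a, ∑ b, (A a b * x a ^ 2 + A a b * x b ^ 2) := by
    simp only [Matrix.mulVec, dotProduct, Finset.mul_sum]
    gcongr with a _ b _
    nlinarith [mul_nonneg (hnn a b) (sq_nonneg (x a - x b))]
  simp only [Finset.sum_add_distrib, h₁, h₂] at h₃
  linarith

/-- If `Z = [[Z_UU, Z_UV],[Z_UVᵀ, Z_VV]]` is positive semidefinite and its
diagonal blocks are stochastic (entrywise nonnegative with row sums `1`), then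
`λ_max(Z) ≤ 2`; equivalently `vᵀ Z v ≤ 2‖v‖²` for every `v`. -/
theorem stmt9 (n m : ℕ)
    (ZUU : Matrix (Fin n) (Fin n) ℝ) (ZUV : Matrix (Fin n) (Fin m) ℝ)
    (ZVV : Matrix (Fin m) (Fin m) ℝ)
    (hpsd : (Matrix.fromBlocks ZUU ZUV ZUVᵀ ZVV).PosSemidef)
    (hUnn : ∀ a b, 0 ≤ ZUU a b) (hUs : ZUU *ᵥ (1 : Fin n → ℝ) = 1)
    (hVnn : ∀ a b, 0 ≤ ZVV a b) (hVs : ZVV *ᵥ (1 : Fin m → ℝ) = 1) :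
    ∀ v : Fin n ⊕ Fin m → ℝ,
      v ⬝ᵥ ((Matrix.fromBlocks ZUU ZUV ZUVᵀ ZVV) *ᵥ v) ≤ 2 * ∑ a, v a ^ 2 := by
  have hsymm := Matrix.isHermitian_fromBlocks_iff.mp hpsd.isHermitian
  have hU : ZUU.IsSymm := by simpa [Matrix.IsHermitian, Matrix.IsSymm] using hsymm.1
  have hV : ZVV.IsSymm := by simpa [Matrix.IsHermitian, Matrix.IsSymm] using hsymm.2.2.2
  intro v
  obtain ⟨x, y, rfl⟩ : ∃ x y, v = Sum.elim x y := ⟨_, _, (Sum.elim_comp_inl_inr v).symm⟩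
  have hx := Matrix.dotProduct_mulVec_le_sum_sq_of_stochastic hU hUnn hUs x
  have hy := Matrix.dotProduct_mulVec_le_sum_sq_of_stochastic hV hVnn hVs y
  have hneg := hpsd.dotProduct_mulVec_nonneg (Sum.elim x (-y))
  simp only [star_trivial, Matrix.fromBlocks_mulVec, Sum.elim_comp_inl, Sum.elim_comp_inr,
    sumElim_dotProduct_sumElim, dotProduct_add, Matrix.mulVec_neg, dotProduct_neg,
    neg_dotProduct, Fintype.sum_sum_type, Sum.elim_inl, Sum.elim_inr] at hneg ⊢
  linarith
end

section
/- Let A ∈ ℝ^{n×m} and let k be a positive integer. Let T_U ∈ {0,1}^{r×n} be a grouping matrix (every column of T_U has exactly one entry equal to 1 and every row has at least one entry equal to 1), and let T_V ∈ {0,1}^{s×m} be a grouping matrix likewise. Suppose Z̄ = [[Z̄_UU, Z̄_UV],[Z̄_UVᵀ, Z̄_VV]] ∈ 𝕊^{r+s} is positive semidefinite and entrywise nonnegative and satisfies Z̄_UU T_U 1_n = 1_r, Z̄_VV T_V 1_m = 1_s, ⟨T_U T_Uᵀ, Z̄_UU⟩ = k, and ⟨T_V T_Vᵀ, Z̄_VV⟩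 = k. Define Z = Tᵀ Z̄ T ∈ 𝕊^{n+m} with T = [[T_U, 0],[0, T_V]], and write Z = [[Z_UU, Z_UV],[Z_UVᵀ, Z_VV]]. Then: Z is positive semidefinite and entrywise nonnegative; Z_UU 1_n = 1_n and tr(Z_UU) = k; Z_VV 1_m = 1_m and tr(Z_VV) = k; whenever two column indices i, j of T_U lie in the same group (i.e., (T_U)_{ℓi} = (T_U)_{ℓj} = 1 for some row ℓ), one has (Z_UU)_{ih} = (Z_UU)_{jh} for all h ∈ {1,…,n} and (Z_UV)_{ih'} = (Z_UV)_{jh'} for all h' ∈ {1,…,m}, and analogously for column indices of T_V; and (1/2)·tr(W Z) = ⟨T_U A T_Vᵀ, Z̄_UV⟩ where W = [[0, A],[Aᵀ, 0]]. -/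
open Matrix BigOperators

section GroupingMatrix

variable {ι κ α β : Type*}

/-- Two columns of a `0/1` matrix with a single `1` in each column agree as soon as they share
a row in which both have a `1`. -/
theorem Matrix.col_eq_of_grouped {T : Matrix ι α ℝ} (hbin : ∀ l i, T l i = 0 ∨ T l i = 1)
    (hcol : ∀ i, ∃! l, T l i = 1) {i j : α} (hij : ∃ l, T l i = 1 ∧ T l j = 1) (l : ι) :
    T l i = T l j := by
  obtain ⟨l₀, hi, hj⟩ := hij
  have key : ∀ a, T l₀ a = 1 → l ≠ l₀ → T l a = 0 := fun a ha hl =>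
    (hbin l a).resolve_right fun h => hl ((hcol a).unique h ha)
  by_cases hl : l = l₀
  · rw [hl, hi, hj]
  · rw [key i hi hl, key j hj hl]

variable [Fintype ι] [Fintype κ]

/-- If two columns of `T` agree, then so do the corresponding rows of `Tᵀ * Z * S`. -/
theorem Matrix.transpose_mul_mul_apply_congr {T : Matrix ι α ℝ} {i j : α}
    (h : ∀ l, T l i = T l j) (Z : Matrix ι κ ℝ) (S : Matrix κ β ℝ) (b : β) :
    (Tᵀ * Z * S) i b = (Tᵀ * Z * S) j b := by
  simp only [mul_apply, transpose_apply, h]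

/-- If each column of `T` has exactly one nonzero entry, which is `1`, then `Tᵀ` maps the
all-ones vector to the all-ones vector. -/
theorem Matrix.transpose_mulVec_one_of_grouping {T : Matrix ι α ℝ}
    (hbin : ∀ l i, T l i = 0 ∨ T l i = 1) (hcol : ∀ i, ∃! l, T l i = 1) :
    Tᵀ *ᵥ (1 : ι → ℝ) = 1 := by
  ext i
  obtain ⟨l₀, h₀, hu⟩ := hcol i
  simp only [mulVec, dotProduct, transpose_apply, Pi.one_apply, mul_one]
  rw [Finset.sum_eq_single l₀ (fun l _ hl => (hbin l i).resolve_right fun h => hl (hu l h))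
    (fun h => absurd (Finset.mem_univ l₀) h)]
  exact h₀

/-- The product `Tᵀ * Z * S` of entrywise nonnegative matrices is entrywise nonnegative. -/
theorem Matrix.transpose_mul_mul_nonneg {T : Matrix ι α ℝ} {Z : Matrix ι κ ℝ} {S : Matrix κ β ℝ}
    (hT : ∀ l i, 0 ≤ T l i) (hZ : ∀ a b, 0 ≤ Z a b) (hS : ∀ l i, 0 ≤ S l i) (a : α) (b : β) :
    0 ≤ (Tᵀ * Z * S) a b := by
  simp only [mul_apply, transpose_apply]
  exact Finset.sum_nonneg fun y _ => mul_nonneg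
    (Finset.sum_nonneg fun x _ => mul_nonneg (hT _ _) (hZ _ _)) (hS _ _)

variable [Fintype α] [Fintype β]

/-- Row sums of the expansion `Tᵀ * Z * T` of a matrix `Z` along a grouping matrix `T`. -/
theorem Matrix.transpose_mul_mul_mulVec_one {T : Matrix ι α ℝ}
    (hbin : ∀ l i, T l i = 0 ∨ T l i = 1) (hcol : ∀ i, ∃! l, T l i = 1) {Z : Matrix ι ι ℝ}
    (hZ : Z *ᵥ (T *ᵥ (1 : α → ℝ)) = 1) :
    (Tᵀ * Z * T) *ᵥ (1 : α → ℝ) = 1 := by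
  rw [← mulVec_mulVec, ← mulVec_mulVec, hZ, transpose_mulVec_one_of_grouping hbin hcol]

theorem Matrix.trace_transpose_mul_mul (T : Matrix ι α ℝ) (Z : Matrix ι ι ℝ) :
    (Tᵀ * Z * T).trace = ((T * Tᵀ) * Z).trace := by
  rw [trace_mul_comm, Matrix.mul_assoc]

theorem Matrix.trace_mul_transpose_mul_mul (A : Matrix α β ℝ) (T : Matrix ι α ℝ)
    (S : Matrix κ β ℝ) (Z : Matrix ι κ ℝ) :
    (A * (Sᵀ * Zᵀ * T)).trace = (Zᵀ * (T * A * Sᵀ)).trace := by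
  rw [trace_mul_comm, Matrix.mul_assoc Sᵀ, Matrix.mul_assoc Sᵀ, trace_mul_comm Sᵀ]
  simp only [Matrix.mul_assoc]

end GroupingMatrix

/-- Expanding a feasible solution `Z̄` of the reduced (shrunken) SDP via the
grouping matrices `T_U, T_V` yields a matrix `Z = Tᵀ Z̄ T` that is feasible for the
original SDP relaxation, satisfies the must-link constraints, and attains the same
objective value: `(1/2)·tr(W Z) = ⟨T_U A T_Vᵀ, Z̄_UV⟩`. -/
theorem stmt13 (n m r s k : ℕ) (hk : 0 < k)
    (A : Matrix (Fin n) (Fin m) ℝ)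
    (TU : Matrix (Fin r) (Fin n) ℝ) (TV : Matrix (Fin s) (Fin m) ℝ)
    (hTUbin : ∀ l i, TU l i = 0 ∨ TU l i = 1)
    (hTUcol : ∀ i, ∃! l, TU l i = 1)
    (hTUrow : ∀ l, ∃ i, TU l i = 1)
    (hTVbin : ∀ l j, TV l j = 0 ∨ TV l j = 1)
    (hTVcol : ∀ j, ∃! l, TV l j = 1)
    (hTVrow : ∀ l, ∃ j, TV l j = 1)
    (ZbUU : Matrix (Fin r) (Fin r) ℝ) (ZbUV : Matrix (Fin r) (Fin s) ℝ)
    (ZbVV : Matrix (Fin s) (Fin s) ℝ)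
    (hZbUU : ZbUU.IsSymm) (hZbVV : ZbVV.IsSymm)
    (hpsd : (Matrix.fromBlocks ZbUU ZbUV ZbUVᵀ ZbVV).PosSemidef)
    (hnn : ∀ a b, 0 ≤ Matrix.fromBlocks ZbUU ZbUV ZbUVᵀ ZbVV a b)
    (hrU : ZbUU *ᵥ (TU *ᵥ (1 : Fin n → ℝ)) = 1)
    (hrV : ZbVV *ᵥ (TV *ᵥ (1 : Fin m → ℝ)) = 1)
    (htU : ((TU * TUᵀ) * ZbUU).trace = (k : ℝ))
    (htV : ((TV * TVᵀ) * ZbVV).trace = (k : ℝ)) :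
    ∀ Z : Matrix (Fin n ⊕ Fin m) (Fin n ⊕ Fin m) ℝ,
      Z = (Matrix.fromBlocks TU 0 0 TV)ᵀ *
        (Matrix.fromBlocks ZbUU ZbUV ZbUVᵀ ZbVV) * (Matrix.fromBlocks TU 0 0 TV) →
      Z.PosSemidef ∧ (∀ a b, 0 ≤ Z a b) ∧
      (TUᵀ * ZbUU * TU) *ᵥ (1 : Fin n → ℝ) = 1 ∧
      (TUᵀ * ZbUU * TU).trace = (k : ℝ) ∧
      (TVᵀ * ZbVV * TV) *ᵥ (1 : Fin m → ℝ) = 1 ∧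
      (TVᵀ * ZbVV * TV).trace = (k : ℝ) ∧
      (∀ i j : Fin n, (∃ l, TU l i = 1 ∧ TU l j = 1) →
        (∀ h, (TUᵀ * ZbUU * TU) i h = (TUᵀ * ZbUU * TU) j h) ∧
        (∀ h', (TUᵀ * ZbUV * TV) i h' = (TUᵀ * ZbUV * TV) j h')) ∧
      (∀ i j : Fin m, (∃ l, TV l i = 1 ∧ TV l j = 1) →
        (∀ h, (TVᵀ * ZbVV * TV) i h = (TVᵀ * ZbVV * TV) j h) ∧
        (∀ h', (TVᵀ * ZbUVᵀ * TU) i h' = (TVᵀ * ZbUVᵀ * TU) j h')) ∧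
      (1 / 2 : ℝ) * ((Matrix.fromBlocks 0 A Aᵀ 0) * Z).trace =
        (ZbUVᵀ * (TU * A * TVᵀ)).trace := by
  rintro Z rfl
  have nonneg_of_bin {x : ℝ} (h : x = 0 ∨ x = 1) : 0 ≤ x := by
    rcases h with rfl | rfl <;> norm_num
  refine ⟨?_, ?_, transpose_mul_mul_mulVec_one hTUbin hTUcol hrU,
    (trace_transpose_mul_mul TU ZbUU).trans htU, transpose_mul_mul_mulVec_one hTVbin hTVcol hrV,
    (trace_transpose_mul_mul TV ZbVV).trans htV, fun i j hij => ?_, fun i j hij => ?_, ?_⟩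
  · simpa only [conjTranspose_eq_transpose_of_trivial] using
      hpsd.conjTranspose_mul_mul_same (fromBlocks TU 0 0 TV)
  · have hT : ∀ a b, 0 ≤ fromBlocks TU 0 0 TV a b := by
      rintro (a | a) (b | b)
      · exact nonneg_of_bin (hTUbin a b)
      · exact le_rfl
      · exact le_rfl
      · exact nonneg_of_bin (hTVbin a b)
    exact transpose_mul_mul_nonneg hT hnn hT
  · have h := col_eq_of_grouped hTUbin hTUcol hij
    exact ⟨transpose_mul_mul_apply_congr h _ _, transpose_mul_mul_apply_congr h _ _⟩
  · have h := col_eq_of_grouped hTVbin hTVcol hij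
    exact ⟨transpose_mul_mul_apply_congr h _ _, transpose_mul_mul_apply_congr h _ _⟩
  · have h_lower : (Aᵀ * (TUᵀ * ZbUV * TV)).trace = (A * (TVᵀ * ZbUVᵀ * TU)).trace := by
      rw [← trace_transpose, trace_mul_comm A]
      simp only [transpose_mul, transpose_transpose, Matrix.mul_assoc]
    have h_trace : (fromBlocks 0 A Aᵀ 0 * ((fromBlocks TU 0 0 TV)ᵀ *
        fromBlocks ZbUU ZbUV ZbUVᵀ ZbVV * fromBlocks TU 0 0 TV)).trace =
        (A * (TVᵀ * ZbUVᵀ * TU)).trace + (Aᵀ * (TUᵀ * ZbUV * TV)).trace := by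
      simp [fromBlocks_transpose, fromBlocks_multiply, trace, Fintype.sum_sum_type]
    rw [h_trace, h_lower, trace_mul_transpose_mul_mul]
    ring
end

section
/- Let A ∈ ℝ^{n×m} and let k be a positive integer. Let T_U ∈ {0,1}^{r×n} and T_V ∈ {0,1}^{s×m} be grouping matrices (every column has exactly one entry equal to 1 and every row has at least one entry equal to 1), and set C_U = T_U T_Uᵀ and C_V = T_V T_Vᵀ (diagonal matrices with the positive group sizes on the diagonal, hence invertible). Suppose Z = [[Z_UU, Z_UV],[Z_UVᵀ, Z_VV]] ∈ 𝕊^{n+m} is positive semidefinite and entrywise nonnegative, satisfies Z_UU 1_n = 1_n, Z_VV 1_m = 1_m, tr(Z_UU) = k, tr(Z_VV) = k, and satisfies the must-link constraints: whenever two column indices i, j of T_U lie in the same group, (Z_UU)_{ih} = (Z_UU)_{jh} for all h and (Z_UV)_{ih'} = (Z_UV)_{jh'} for all h', and analogously whenever two column indices of T_V lie in the same group, the corresponding rows of Z_VV and of Z_UVᵀ coincide. Define Z̄ = M Z Mᵀ ∈ 𝕊^{r+s} where M = [[C_U^{-1} T_U, 0],[0, C_V^{-1} T_V]], writing Z̄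 = [[Z̄_UU, Z̄_UV],[Z̄_UVᵀ, Z̄_VV]]. Then Z̄ is positive semidefinite and entrywise nonnegative, Z̄_UU T_U 1_n = 1_r, Z̄_VV T_V 1_m = 1_s, ⟨T_U T_Uᵀ, Z̄_UU⟩ = k, ⟨T_V T_Vᵀ, Z̄_VV⟩ = k, and ⟨T_U A T_Vᵀ, Z̄_UV⟩ = (1/2)·tr(W Z) where W = [[0, A],[Aᵀ, 0]]. -/
open Matrix BigOperators

section Grouping

variable {ι κ η : Type*} {T : Matrix κ ι ℝ}

theorem grouping_nonneg (hbin : ∀ l i, T l i = 0 ∨ T l i = 1) (l : κ) (i : ι) : 0 ≤ T l i := by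
  rcases hbin l i with h | h <;> simp [h]

theorem transpose_grouping_mul_one [Fintype κ] (hbin : ∀ l i, T l i = 0 ∨ T l i = 1)
    (hcol : ∀ i, ∃! l, T l i = 1) : Tᵀ *ᵥ (1 : κ → ℝ) = 1 := by
  ext i
  obtain ⟨l, hl, huniq⟩ := hcol i
  simp only [mulVec, dotProduct, transpose_apply, Pi.one_apply, mul_one]
  rw [Finset.sum_eq_single l, hl]
  · intro b _ hb
    exact (hbin b i).resolve_right fun h => hb (huniq b h)
  · simp

variable [Fintype ι]

theorem grouping_row_sum_pos (hbin : ∀ l i, T l i = 0 ∨ T l i = 1)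
    (hrow : ∀ l, ∃ i, T l i = 1) (l : κ) : 0 < ∑ i, T l i := by
  obtain ⟨i, hi⟩ := hrow l
  exact Finset.sum_pos' (fun i _ => grouping_nonneg hbin l i) ⟨i, Finset.mem_univ i, by simp [hi]⟩

variable [DecidableEq κ]

/-- The rows of a grouping matrix are orthogonal, and their squared norms are the group sizes. -/
theorem grouping_mul_transpose (hbin : ∀ l i, T l i = 0 ∨ T l i = 1)
    (hcol : ∀ i, ∃! l, T l i = 1) : T * Tᵀ = diagonal fun l => ∑ i, T l i := by
  ext a b
  rw [mul_apply, diagonal_apply]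
  split_ifs with hab
  · subst hab
    refine Finset.sum_congr rfl fun i _ => ?_
    rcases hbin a i with h | h <;> simp [h]
  · refine Finset.sum_eq_zero fun i _ => ?_
    rcases hbin a i with h | h
    · simp [h]
    rcases hbin b i with h' | h'
    · simp [h']
    exact absurd ((hcol i).unique h h') hab

variable [Fintype κ]

theorem isUnit_det_grouping (hbin : ∀ l i, T l i = 0 ∨ T l i = 1)
    (hcol : ∀ i, ∃! l, T l i = 1) (hrow : ∀ l, ∃ i, T l i = 1) : IsUnit (T * Tᵀ).det := by
  rw [grouping_mul_transpose hbin hcol, det_diagonal, isUnit_iff_ne_zero]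
  exact Finset.prod_ne_zero_iff.2 fun l _ => (grouping_row_sum_pos hbin hrow l).ne'

theorem grouping_average_nonneg (hbin : ∀ l i, T l i = 0 ∨ T l i = 1)
    (hcol : ∀ i, ∃! l, T l i = 1) (hrow : ∀ l, ∃ i, T l i = 1) (l : κ) (i : ι) :
    0 ≤ ((T * Tᵀ)⁻¹ * T) l i := by
  have hinv : (T * Tᵀ)⁻¹ = diagonal fun l => (∑ i, T l i)⁻¹ := by
    refine inv_eq_right_inv ?_
    rw [grouping_mul_transpose hbin hcol, diagonal_mul_diagonal, ← diagonal_one]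
    exact congrArg _ (funext fun l => mul_inv_cancel₀ (grouping_row_sum_pos hbin hrow l).ne')
  rw [hinv, diagonal_mul]
  exact mul_nonneg (inv_nonneg.2 (grouping_row_sum_pos hbin hrow l).le) (grouping_nonneg hbin l i)

theorem transpose_grouping_average_mul :
    ((T * Tᵀ)⁻¹ * T)ᵀ * T = Tᵀ * ((T * Tᵀ)⁻¹ * T) := by
  rw [transpose_mul, transpose_nonsing_inv, transpose_mul, transpose_transpose, Matrix.mul_assoc]

theorem grouping_average_mul_one (hbin : ∀ l i, T l i = 0 ∨ T l i = 1)
    (hcol : ∀ i, ∃! l, T l i = 1) (hrow : ∀ l, ∃ i, T l i = 1) :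
    ((T * Tᵀ)⁻¹ * T) *ᵥ (1 : ι → ℝ) = 1 := by
  rw [← transpose_grouping_mul_one hbin hcol, mulVec_mulVec, Matrix.mul_assoc,
    nonsing_inv_mul _ (isUnit_det_grouping hbin hcol hrow), one_mulVec]

/-- The averaging projection fixes every matrix whose rows are constant on groups. -/
theorem grouping_projection_mul (hbin : ∀ l i, T l i = 0 ∨ T l i = 1)
    (hcol : ∀ i, ∃! l, T l i = 1) (hrow : ∀ l, ∃ i, T l i = 1) {Z : Matrix ι η ℝ}
    (hZ : ∀ i j, (∃ l, T l i = 1 ∧ T l j = 1) → ∀ h, Z i h = Z j h) :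
    Tᵀ * ((T * Tᵀ)⁻¹ * T) * Z = Z := by
  choose rep hrep using hrow
  have hfac : Z = Tᵀ * Z.submatrix rep id := by
    ext i h
    obtain ⟨l, hl, huniq⟩ := hcol i
    rw [mul_apply, Finset.sum_eq_single l]
    · simp [hl, hZ i (rep l) ⟨l, hl, hrep l⟩ h]
    · intro b _ hb
      simp [(hbin b i).resolve_right fun h => hb (huniq b h)]
    · simp
  have hunit := isUnit_det_grouping hbin hcol fun l => ⟨rep l, hrep l⟩
  have hmul : Tᵀ * ((T * Tᵀ)⁻¹ * T) * Tᵀ = Tᵀ := by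
    rw [Matrix.mul_assoc, Matrix.mul_assoc, nonsing_inv_mul _ hunit, Matrix.mul_one]
  rw [hfac, ← Matrix.mul_assoc, hmul]

theorem grouping_reduced_row_sum (hbin : ∀ l i, T l i = 0 ∨ T l i = 1)
    (hcol : ∀ i, ∃! l, T l i = 1) (hrow : ∀ l, ∃ i, T l i = 1) {Z : Matrix ι ι ℝ}
    (hsymm : Z.IsSymm) (hZ : ∀ i j, (∃ l, T l i = 1 ∧ T l j = 1) → ∀ h, Z i h = Z j h)
    (hone : Z *ᵥ (1 : ι → ℝ) = 1) :
    ((T * Tᵀ)⁻¹ * T * Z * ((T * Tᵀ)⁻¹ * T)ᵀ) *ᵥ (T *ᵥ (1 : ι → ℝ)) = 1 := by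
  have hP := congrArg transpose (grouping_projection_mul hbin hcol hrow hZ)
  rw [transpose_mul, transpose_mul, transpose_transpose, hsymm.eq] at hP
  rw [mulVec_mulVec, Matrix.mul_assoc _ _ T, Matrix.mul_assoc _ Z, hP, ← mulVec_mulVec, hone,
    grouping_average_mul_one hbin hcol hrow]

theorem grouping_reduced_trace (hbin : ∀ l i, T l i = 0 ∨ T l i = 1)
    (hcol : ∀ i, ∃! l, T l i = 1) (hrow : ∀ l, ∃ i, T l i = 1) {Z : Matrix ι ι ℝ}
    (hZ : ∀ i j, (∃ l, T l i = 1 ∧ T l j = 1) → ∀ h, Z i h = Z j h) :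
    (T * Tᵀ * ((T * Tᵀ)⁻¹ * T * Z * ((T * Tᵀ)⁻¹ * T)ᵀ)).trace = Z.trace := by
  have hP := grouping_projection_mul hbin hcol hrow hZ
  have hcancel : T * Tᵀ * ((T * Tᵀ)⁻¹ * T) = T :=
    mul_nonsing_inv_cancel_left _ _ (isUnit_det_grouping hbin hcol hrow)
  rw [← Matrix.mul_assoc, ← Matrix.mul_assoc, hcancel, trace_mul_comm, ← Matrix.mul_assoc,
    transpose_grouping_average_mul, hP]

end Grouping

theorem nonneg_mul_apply {ι κ η : Type*} [Fintype κ] {B : Matrix ι κ ℝ} {C : Matrix κ η ℝ}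
    (hB : ∀ i j, 0 ≤ B i j) (hC : ∀ i j, 0 ≤ C i j) (i : ι) (j : η) : 0 ≤ (B * C) i j := by
  rw [mul_apply]
  exact Finset.sum_nonneg fun l _ => mul_nonneg (hB i l) (hC l j)

/-- Shrinking a feasible solution `Z` of the original SDP relaxation that
satisfies the must-link constraints, via `Z̄ = M Z Mᵀ` with
`M = [[C_U⁻¹ T_U, 0],[0, C_V⁻¹ T_V]]`, `C_U = T_U T_Uᵀ`, `C_V = T_V T_Vᵀ`, yields a
feasible solution of the reduced SDP with the same objective value:
`⟨T_U A T_Vᵀ, Z̄_UV⟩ = (1/2)·tr(W Z)`. -/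
theorem stmt14 (n m r s k : ℕ) (hk : 0 < k)
    (A : Matrix (Fin n) (Fin m) ℝ)
    (TU : Matrix (Fin r) (Fin n) ℝ) (TV : Matrix (Fin s) (Fin m) ℝ)
    (hTUbin : ∀ l i, TU l i = 0 ∨ TU l i = 1)
    (hTUcol : ∀ i, ∃! l, TU l i = 1)
    (hTUrow : ∀ l, ∃ i, TU l i = 1)
    (hTVbin : ∀ l j, TV l j = 0 ∨ TV l j = 1)
    (hTVcol : ∀ j, ∃! l, TV l j = 1)
    (hTVrow : ∀ l, ∃ j, TV l j = 1)
    (ZUU : Matrix (Fin n) (Fin n) ℝ) (ZUV : Matrix (Fin n) (Fin m) ℝ)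
    (ZVV : Matrix (Fin m) (Fin m) ℝ)
    (hZUU : ZUU.IsSymm) (hZVV : ZVV.IsSymm)
    (hpsd : (Matrix.fromBlocks ZUU ZUV ZUVᵀ ZVV).PosSemidef)
    (hnn : ∀ a b, 0 ≤ Matrix.fromBlocks ZUU ZUV ZUVᵀ ZVV a b)
    (hrU : ZUU *ᵥ (1 : Fin n → ℝ) = 1) (hrV : ZVV *ᵥ (1 : Fin m → ℝ) = 1)
    (htU : ZUU.trace = (k : ℝ)) (htV : ZVV.trace = (k : ℝ))
    (hmlU : ∀ i j : Fin n, (∃ l, TU l i = 1 ∧ TU l j = 1) →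
      (∀ h, ZUU i h = ZUU j h) ∧ (∀ h', ZUV i h' = ZUV j h'))
    (hmlV : ∀ i j : Fin m, (∃ l, TV l i = 1 ∧ TV l j = 1) →
      (∀ h, ZVV i h = ZVV j h) ∧ (∀ h', ZUVᵀ i h' = ZUVᵀ j h')) :
    ∀ MU MV : _,
      MU = (TU * TUᵀ)⁻¹ * TU →
      MV = (TV * TVᵀ)⁻¹ * TV →
      ∀ Zb : Matrix (Fin r ⊕ Fin s) (Fin r ⊕ Fin s) ℝ,
        Zb = (Matrix.fromBlocks MU 0 0 MV) *
          (Matrix.fromBlocks ZUU ZUV ZUVᵀ ZVV) * (Matrix.fromBlocks MU 0 0 MV)ᵀ →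
        Zb.PosSemidef ∧ (∀ a b, 0 ≤ Zb a b) ∧
        (MU * ZUU * MUᵀ) *ᵥ (TU *ᵥ (1 : Fin n → ℝ)) = 1 ∧
        (MV * ZVV * MVᵀ) *ᵥ (TV *ᵥ (1 : Fin m → ℝ)) = 1 ∧
        ((TU * TUᵀ) * (MU * ZUU * MUᵀ)).trace = (k : ℝ) ∧
        ((TV * TVᵀ) * (MV * ZVV * MVᵀ)).trace = (k : ℝ) ∧
        ((MU * ZUV * MVᵀ)ᵀ * (TU * A * TVᵀ)).trace =
          (1 / 2 : ℝ) * ((Matrix.fromBlocks 0 A Aᵀ 0) *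
            (Matrix.fromBlocks ZUU ZUV ZUVᵀ ZVV)).trace := by
  rintro MU MV rfl rfl Zb rfl
  have hM : ∀ a b, 0 ≤ fromBlocks ((TU * TUᵀ)⁻¹ * TU) 0 0 ((TV * TVᵀ)⁻¹ * TV) a b := by
    rintro (a | a) (b | b)
    · exact grouping_average_nonneg hTUbin hTUcol hTUrow a b
    · exact le_rfl
    · exact le_rfl
    · exact grouping_average_nonneg hTVbin hTVcol hTVrow a b
  refine ⟨?_, nonneg_mul_apply (nonneg_mul_apply hM hnn) fun i j => hM j i,
    grouping_reduced_row_sum hTUbin hTUcol hTUrow hZUU (fun i j h => (hmlU i j h).1) hrU,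
    grouping_reduced_row_sum hTVbin hTVcol hTVrow hZVV (fun i j h => (hmlV i j h).1) hrV,
    (grouping_reduced_trace hTUbin hTUcol hTUrow fun i j h => (hmlU i j h).1).trans htU,
    (grouping_reduced_trace hTVbin hTVcol hTVrow fun i j h => (hmlV i j h).1).trans htV, ?_⟩
  · simpa only [conjTranspose_eq_transpose_of_trivial] using
      hpsd.mul_mul_conjTranspose_same (fromBlocks ((TU * TUᵀ)⁻¹ * TU) 0 0 ((TV * TVᵀ)⁻¹ * TV))
  · have hPU := grouping_projection_mul hTUbin hTUcol hTUrow fun i j h => (hmlU i j h).2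
    have hPV := grouping_projection_mul hTVbin hTVcol hTVrow fun i j h => (hmlV i j h).2
    replace hPU := congrArg transpose hPU
    rw [transpose_mul, transpose_mul, transpose_transpose] at hPU
    generalize (TU * TUᵀ)⁻¹ * TU = MU at *
    generalize (TV * TVᵀ)⁻¹ * TV = MV at *
    have hleft : ((MU * ZUV * MVᵀ)ᵀ * (TU * A * TVᵀ)).trace = (ZUVᵀ * A).trace := by
      calc ((MU * ZUV * MVᵀ)ᵀ * (TU * A * TVᵀ)).trace
          = (MV * (ZUVᵀ * (MUᵀ * TU) * A) * TVᵀ).trace := by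
            simp only [transpose_mul, transpose_transpose, Matrix.mul_assoc]
        _ = (TVᵀ * MV * ZUVᵀ * (MUᵀ * TU) * A).trace := by
            rw [trace_mul_comm]
            simp only [Matrix.mul_assoc]
        _ = (ZUVᵀ * A).trace := by
            rw [hPV, hPU]
    have hright : (Aᵀ * ZUV).trace = (ZUVᵀ * A).trace := by
      rw [← trace_transpose, transpose_mul, transpose_transpose]
    have htrace : (fromBlocks 0 A Aᵀ 0 * fromBlocks ZUU ZUV ZUVᵀ ZVV).trace
        = (A * ZUVᵀ).trace + (Aᵀ * ZUV).trace := by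
      simp [fromBlocks_multiply, trace, Fintype.sum_sum_type]
    rw [hleft, htrace, hright, trace_mul_comm A]
    ring
end
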